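/- Let Γ be a numerical monoid with minimal generators g_0 < g_1 < ... < g_e, let C ⊆ {g_1, ..., g_e} be a subset with |C| = t. If Ap(Γ) = {0, g_1, ..., g_e} ∪ (C + C) and g_0 = e + 1 + binom(t+1, 2), then g_0 > t(t+1). Here C + C = {c + c' : c, c' ∈ C} is the sumset. -/

import Mathlib

open scoped Pointwise

/-- A numerical monoid: an additive submonoid of ℕ with finite complement. -/
def IsNumericalMonoid (Γ : AddSubmonoid ℕ) : Prop :=
  ((Γ : Set ℕ)ᶜ).Finite

/-- The (unique) minimal generating set of a submonoid of ℕ: the nonzero elements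
that are not sums of two nonzero elements. -/
def minGens (Γ : AddSubmonoid ℕ) : Set ℕ :=
  {g | g ∈ Γ ∧ g ≠ 0 ∧ ∀ a ∈ Γ, ∀ b ∈ Γ, a ≠ 0 → b ≠ 0 → g ≠ a + b}

/-- Embedding dimension: the number of minimal generators. -/
noncomputable def edim (Γ : AddSubmonoid ℕ) : ℕ :=
  (minGens Γ).ncard

/-- Multiplicity: the smallest nonzero element. -/
noncomputable def mult (Γ : AddSubmonoid ℕ) : ℕ :=
  sInf {g : ℕ | g ∈ Γ ∧ g ≠ 0}

/-- The factorization homomorphism φ, sending a formal ℕ-combination of the minimal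
generators to its value in ℕ. -/
noncomputable def factorizationHom (Γ : AddSubmonoid ℕ) : (minGens Γ →₀ ℕ) →+ ℕ :=
  Finsupp.liftAddHom fun g => AddMonoidHom.mulLeft (g : ℕ)

/-- The number of minimal relations ρ(Γ): the least cardinality of a set of pairs
generating the kernel congruence of the factorization homomorphism. -/
noncomputable def rho (Γ : AddSubmonoid ℕ) : ℕ :=
  sInf {n : ℕ | ∃ R : Set ((minGens Γ →₀ ℕ) × (minGens Γ →₀ ℕ)),
    R.Finite ∧ R.ncard = n ∧
    addConGen (fun a b => (a, b) ∈ R) = AddCon.ker (factorizationHom Γ)}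

/-- Pseudo-Frobenius numbers of Γ. -/
def pseudoFrobenius (Γ : AddSubmonoid ℕ) : Set ℕ :=
  {p | p ∉ Γ ∧ ∀ g ∈ Γ, g ≠ 0 → p + g ∈ Γ}

/-- The type of Γ: the number of pseudo-Frobenius numbers. -/
noncomputable def numType (Γ : AddSubmonoid ℕ) : ℕ :=
  (pseudoFrobenius Γ).ncard

/-- The Apéry set of Γ with respect to its multiplicity. -/
def aperySet (Γ : AddSubmonoid ℕ) : Set ℕ :=
  {g | g ∈ Γ ∧ ¬ ∃ γ ∈ Γ, g = γ + mult Γ}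

/-- The Macaulay upper function: if `n = C(n_d,d) + ⋯ + C(n_j,j)` is the Macaulay
expansion of `n`, then `macUpper d n = C(n_d+1,d+1) + ⋯ + C(n_j+1,j+1)`, i.e. `n^⟨d⟩`. -/
noncomputable def macUpper : ℕ → ℕ → ℕ
  | 0, _ => 0
  | d + 1, n =>
    if n = 0 then 0
    else
      Nat.choose (sSup {a : ℕ | Nat.choose a (d + 1) ≤ n} + 1) (d + 2) +
        macUpper d (n - Nat.choose (sSup {a : ℕ | Nat.choose a (d + 1) ≤ n}) (d + 1))

/-- The Macaulay lower function: if `n = C(n_d,d) + ⋯ + C(n_j,j)` is the Macaulay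
expansion of `n`, then `macLower d n = C(n_d-1,d) + ⋯ + C(n_j-1,j)`, i.e. `n_⟨d⟩`. -/
noncomputable def macLower : ℕ → ℕ → ℕ
  | 0, _ => 0
  | d + 1, n =>
    if n = 0 then 0
    else
      Nat.choose (sSup {a : ℕ | Nat.choose a (d + 1) ≤ n} - 1) (d + 1) +
        macLower d (n - Nat.choose (sSup {a : ℕ | Nat.choose a (d + 1) ≤ n}) (d + 1))

/-- The unique positive `r` with `C(e+r-1,r-1) ≤ m < C(e+r,r)`. -/
noncomputable def macR (e m : ℕ) : ℕ :=
  sInf {r : ℕ | 0 < r ∧ m < Nat.choose (e + r) r}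

/-- The bound 𝒞(e,m) = C(e+r-1,r) + s^⟨r⟩ - s, where s = m - C(e+r-1,r-1). -/
noncomputable def mathcalC (e m : ℕ) : ℕ :=
  Nat.choose (e + macR e m - 1) (macR e m) +
      macUpper (macR e m) (m - Nat.choose (e + macR e m - 1) (macR e m - 1)) -
    (m - Nat.choose (e + macR e m - 1) (macR e m - 1))

/-- The bound 𝒟(e,m) = C(e+r-2,r-1) + s_⟨r⟩, where s = m - C(e+r-1,r-1). -/
noncomputable def mathcalD (e m : ℕ) : ℕ :=
  Nat.choose (e + macR e m - 2) (macR e m - 1) +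
    macLower (macR e m) (m - Nat.choose (e + macR e m - 1) (macR e m - 1))


theorem mult_mem_and_ne_zero {Γ : AddSubmonoid ℕ} (hΓ : IsNumericalMonoid Γ) :
    mult Γ ∈ Γ ∧ mult Γ ≠ 0 := by
  have hne : {g : ℕ | g ∈ Γ ∧ g ≠ 0}.Nonempty := by
    obtain ⟨g, hg, h0⟩ := hΓ.infinite_compl.exists_gt 0
    exact ⟨g, by simpa using hg, by omega⟩
  exact Nat.sInf_mem hne

theorem mult_le {Γ : AddSubmonoid ℕ} {g : ℕ} (hg : g ∈ Γ) (h0 : g ≠ 0) : mult Γ ≤ g :=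
  Nat.sInf_le ⟨hg, h0⟩

theorem mult_mem_minGens {Γ : AddSubmonoid ℕ} (hΓ : IsNumericalMonoid Γ) :
    mult Γ ∈ minGens Γ := by
  obtain ⟨hm, h0⟩ := mult_mem_and_ne_zero hΓ
  refine ⟨hm, h0, fun a ha b hb ha0 hb0 h => ?_⟩
  have := mult_le ha ha0
  omega

/-- Distinct elements of the Apéry set are incongruent modulo the multiplicity. -/
theorem aperySet_eq_of_natCast_eq {Γ : AddSubmonoid ℕ} (hΓ : IsNumericalMonoid Γ)
    {x y : ℕ} (hx : x ∈ aperySet Γ) (hy : y ∈ aperySet Γ)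
    (h : (x : ZMod (mult Γ)) = y) : x = y := by
  wlog hxy : x ≤ y generalizing x y
  · exact (this hy hx h.symm (by omega)).symm
  obtain ⟨k, hk⟩ := (Nat.modEq_iff_dvd' hxy).1 ((ZMod.natCast_eq_natCast_iff _ _ _).1 h)
  cases k with
  | zero => omega
  | succ k =>
    refine absurd ⟨x + k • mult Γ,
      Γ.add_mem hx.1 (Γ.nsmul_mem (mult_mem_and_ne_zero hΓ).1 k), ?_⟩ hy.2
    rw [smul_eq_mul]
    rw [mul_add, mul_one, mul_comm] at hk
    omega

theorem exists_mem_aperySet_natCast_eq {Γ : AddSubmonoid ℕ} (hΓ : IsNumericalMonoid Γ)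
    (r : ZMod (mult Γ)) : ∃ x ∈ aperySet Γ, (x : ZMod (mult Γ)) = r := by
  classical
  have h0 := (mult_mem_and_ne_zero hΓ).2
  have : NeZero (mult Γ) := ⟨h0⟩
  have hex : ∃ x, x ∈ Γ ∧ (x : ZMod (mult Γ)) = r := by
    obtain ⟨N, hN⟩ := hΓ.bddAbove
    refine ⟨r.val + mult Γ * (N + 1), ?_, by simp⟩
    by_contra hc
    have h1 := hN hc
    have h2 := Nat.le_mul_of_pos_left (N + 1) (Nat.pos_of_ne_zero h0)
    omega
  obtain ⟨hx, hr⟩ := Nat.find_spec hex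
  refine ⟨Nat.find hex, ⟨hx, ?_⟩, hr⟩
  rintro ⟨γ, hγ, h⟩
  refine Nat.find_min hex (m := γ) (by omega) ⟨hγ, ?_⟩
  rw [← hr, h]
  simp

theorem finite_aperySet {Γ : AddSubmonoid ℕ} (hΓ : IsNumericalMonoid Γ) :
    (aperySet Γ).Finite := by
  have : NeZero (mult Γ) := ⟨(mult_mem_and_ne_zero hΓ).2⟩
  exact Set.Finite.of_finite_image (f := fun x : ℕ => (x : ZMod (mult Γ))) (Set.toFinite _)
    fun x hx y hy h => aperySet_eq_of_natCast_eq hΓ hx hy h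

theorem mult_le_ncard_aperySet {Γ : AddSubmonoid ℕ} (hΓ : IsNumericalMonoid Γ) :
    mult Γ ≤ (aperySet Γ).ncard := by
  have himg : (fun x : ℕ => (x : ZMod (mult Γ))) '' aperySet Γ = Set.univ :=
    Set.eq_univ_of_forall fun r => exists_mem_aperySet_natCast_eq hΓ r
  have h := Set.ncard_image_le (f := fun x : ℕ => (x : ZMod (mult Γ))) (finite_aperySet hΓ)
  rwa [himg, Set.ncard_univ, Nat.card_zmod] at h

/-- A finite set with at least `C(#s + 1, 2)` pairwise sums is a Sidon set. -/
theorem sym2_eq_of_add_eq_of_choose_le_card_add {s : Finset ℕ}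
    (h : (s.card + 1).choose 2 ≤ (s + s).card) {a b c d : ℕ}
    (ha : a ∈ s) (hb : b ∈ s) (hc : c ∈ s) (hd : d ∈ s) (he : a + b = c + d) :
    s(a, b) = s(c, d) := by
  let f : Sym2 ℕ → ℕ := Sym2.lift ⟨fun x y => x + y, fun x y => add_comm x y⟩
  have hsub : s + s ⊆ s.sym2.image f := by
    intro x hx
    obtain ⟨y, hy, z, hz, rfl⟩ := Finset.mem_add.1 hx
    exact Finset.mem_image.2 ⟨s(y, z), Finset.mk_mem_sym2_iff.2 ⟨hy, hz⟩, rfl⟩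
  have hinj : Set.InjOn f s.sym2 := by
    refine Finset.card_image_iff.1 (le_antisymm Finset.card_image_le ?_)
    rw [Finset.card_sym2]
    exact h.trans (Finset.card_le_card hsub)
  exact hinj (Finset.mk_mem_sym2_iff.2 ⟨ha, hb⟩) (Finset.mk_mem_sym2_iff.2 ⟨hc, hd⟩) he

/-- If the pairwise sums of `s ⊆ ℕ` determine their summands and stay distinct modulo `m`, then
`m` exceeds the number of ordered pairs of distinct elements of `s`. -/
theorem card_mul_pred_lt_of_sidon {m : ℕ} [NeZero m] {s : Finset ℕ}
    (h : ∀ a ∈ s, ∀ b ∈ s, ∀ c ∈ s, ∀ d ∈ s,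
      ((a + b : ℕ) : ZMod m) = (c + d : ℕ) → s(a, b) = s(c, d)) :
    s.card * (s.card - 1) < m := by
  have hle : s.offDiag.card ≤ ((Finset.univ : Finset (ZMod m)).erase 0).card := by
    refine Finset.card_le_card_of_injOn (fun p => (p.1 : ZMod m) - p.2) ?_ ?_
    · rintro ⟨a, b⟩ hp
      obtain ⟨ha, hb, hab⟩ := Finset.mem_offDiag.1 hp
      refine Finset.mem_coe.2 (Finset.mem_erase.2 ⟨fun h0 => hab ?_, Finset.mem_univ _⟩)
      have := h a ha a ha b hb a ha (by push_cast; linear_combination h0)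
      simp only [Sym2.eq_iff] at this
      tauto
    · rintro ⟨a, b⟩ hp ⟨c, d⟩ hq he
      obtain ⟨ha, hb, hab⟩ := Finset.mem_offDiag.1 hp
      obtain ⟨hc, hd, hcd⟩ := Finset.mem_offDiag.1 hq
      have := h a ha d hd c hc b hb (by push_cast; linear_combination he)
      simp only [Sym2.eq_iff] at this
      simp only [Prod.mk.injEq]
      tauto
  rw [Finset.offDiag_card, Finset.card_erase_of_mem (Finset.mem_univ _), Finset.card_univ,
    ZMod.card] at hle
  have := Nat.pos_of_ne_zero (NeZero.ne m)
  rw [Nat.mul_sub, mul_one]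
  omega

/-- If the Apéry set of Γ is {0, g_1, …, g_e} ∪ (C + C) for a subset C of the
non-multiplicity minimal generators with |C| = t, and g_0 = e + 1 + C(t+1,2),
then g_0 > t(t+1). -/
theorem mult_gt_of_apery_sumset (Γ : AddSubmonoid ℕ) (hΓ : IsNumericalMonoid Γ)
    (C : Set ℕ) (hC : C ⊆ minGens Γ \ {mult Γ}) (t : ℕ) (ht : C.ncard = t)
    (hAp : aperySet Γ = ({0} : Set ℕ) ∪ (minGens Γ \ {mult Γ}) ∪ (C + C))
    (hmult : mult Γ = edim Γ + Nat.choose (t + 1) 2) :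
    t * (t + 1) < mult Γ := by
  classical
  have : NeZero (mult Γ) := ⟨(mult_mem_and_ne_zero hΓ).2⟩
  have hCAp : C ⊆ aperySet Γ := by
    rw [hAp]
    exact fun x hx => Or.inl (Or.inr (hC hx))
  obtain ⟨s, rfl⟩ := ((finite_aperySet hΓ).subset hCAp).exists_finset_coe
  rw [Set.ncard_coe_finset] at ht
  have hGfin : (minGens Γ \ {mult Γ}).Finite :=
    (finite_aperySet hΓ).subset (by rw [hAp]; exact fun x hx => Or.inl (Or.inr hx))
  have hedim : (minGens Γ \ {mult Γ}).ncard + 1 = edim Γ :=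
    Set.ncard_sdiff_singleton_add_one (mult_mem_minGens hΓ)
      (Set.Finite.of_sdiff hGfin (Set.finite_singleton _))
  have hsum : (s.card + 1).choose 2 ≤ (s + s).card := by
    have h1 := mult_le_ncard_aperySet hΓ
    have h2 := Set.ncard_union_le ({0} ∪ (minGens Γ \ {mult Γ})) ((s : Set ℕ) + s)
    have h3 := Set.ncard_union_le {0} (minGens Γ \ {mult Γ})
    rw [← hAp, ← Finset.coe_add, Set.ncard_coe_finset] at h2
    rw [Set.ncard_singleton] at h3
    rw [ht]
    omega
  have hgen : ∀ a ∈ s, a ∈ minGens Γ := fun a ha => (hC ha).1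
  have h0 : 0 ∉ s := fun h => (hgen 0 h).2.1 rfl
  have hne : ∀ a ∈ s, ∀ b ∈ s, ∀ c ∈ s, a ≠ b + c := fun a ha b hb c hc =>
    (hgen a ha).2.2 b (hgen b hb).1 c (hgen c hc).1 (hgen b hb).2.1 (hgen c hc).2.1
  have hAdd : ∀ a ∈ insert 0 s, ∀ b ∈ insert 0 s, a + b ∈ aperySet Γ := by
    intro a ha b hb
    rcases Finset.mem_insert.1 ha with rfl | ha <;> rcases Finset.mem_insert.1 hb with rfl | hb
    · rw [hAp]
      exact Or.inl (Or.inl rfl)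
    · simpa using hCAp hb
    · simpa using hCAp ha
    · rw [hAp]
      exact Or.inr (Set.add_mem_add ha hb)
  have key := card_mul_pred_lt_of_sidon (m := mult Γ) (s := insert 0 s) ?_
  · rw [Finset.card_insert_of_notMem h0, ht] at key
    simpa [mul_comm] using key
  intro a ha b hb c hc d hd h
  have he := aperySet_eq_of_natCast_eq hΓ (hAdd a ha b hb) (hAdd c hc d hd) h
  rw [Finset.mem_insert] at ha hb hc hd
  by_cases hall : (a ∈ s ∧ b ∈ s) ∧ c ∈ s ∧ d ∈ s
  · exact sym2_eq_of_add_eq_of_choose_le_card_add hsum hall.1.1 hall.1.2 hall.2.1 hall.2.2 he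
  · rw [Sym2.eq_iff]
    grind
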